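/- (Local-to-Global Principle) Let X be a connected, compact Hausdorff topological space, Y a connected locally compact complete path metric space, and f: X → Y a continuous map such that: (LC1) f is proper and every x ∈ X has a neighbourhood V_x such that f⁻¹(f(y)) ∩ V_x is connected for all y ∈ V_x; (LC2) every x ∈ X has a pointed closed convex set (C_x, f(x)) and a neighbourhood V_x with f(V_x) ⊆ C_x such that f: V_x → C_x is an open map onto its image in the subspace topology of C_x. Then f(X) is a closed, weakly convex subset of Y. -/

import Mathlib

open Filter Topology Set

noncomputable section

variable {Y : Type*} [MetricSpace Y]

/-- The dilatation (metric derivative) of a map `f` at a point `u`, with the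
supremum restricted to pairs of points of `s`. -/
noncomputable def dilatationOn (f : ℝ → Y) (s : Set ℝ) (u : ℝ) : ℝ :=
  Filter.limsup
    (fun ε : ℝ => sSup ((fun p : ℝ × ℝ => dist (f p.1) (f p.2) / dist p.1 p.2) ''
      {p : ℝ × ℝ | p.1 ∈ s ∧ p.2 ∈ s ∧ p.1 ≠ p.2 ∧ dist p.1 u < ε ∧ dist p.2 u < ε}))
    (nhdsWithin 0 (Set.Ioi 0))

/-- The length of a curve `f : [a,b] → Y`, `L(f) = ∫_a^b dil(f)(t) dt`. -/
noncomputable def curveLength (f : ℝ → Y) (a b : ℝ) : ℝ :=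
  ∫ t in a..b, dilatationOn f (Set.Icc a b) t

/-- A metric space is a path metric space if the distance between any two points
is the infimum of lengths of Lipschitz curves joining them. -/
def IsPathMetricSpace (Y : Type*) [MetricSpace Y] : Prop :=
  ∀ x y : Y, dist x y = sInf {L : ℝ | ∃ (a b : ℝ) (f : ℝ → Y) (K : NNReal), a ≤ b ∧
    LipschitzOnWith K f (Set.Icc a b) ∧ f a = x ∧ f b = y ∧ L = curveLength f a b}

/-- The inner path metric of a set `C`: infimum of lengths of Lipschitz curves
joining `x` to `y` inside `C`. -/
def innerPathDist (C : Set Y) (x y : Y) : ℝ :=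
  sInf {L : ℝ | ∃ (a b : ℝ) (f : ℝ → Y) (K : NNReal), a ≤ b ∧
    LipschitzOnWith K f (Set.Icc a b) ∧ f a = x ∧ f b = y ∧
    f '' Set.Icc a b ⊆ C ∧ L = curveLength f a b}

/-- A set is closed convex if it is closed and its inner path metric agrees with
the ambient distance. -/
def IsClosedConvex (C : Set Y) : Prop :=
  IsClosed C ∧ ∀ x ∈ C, ∀ y ∈ C, innerPathDist C x y = dist x y

/-- `x` and `y` are joined by a global geodesic contained in `S`. -/
def JoinedByGeodesicIn (S : Set Y) (x y : Y) : Prop :=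
  ∃ (a b : ℝ) (c : ℝ → Y) (K : NNReal), a ≤ b ∧ LipschitzOnWith K c (Set.Icc a b) ∧
    c a = x ∧ c b = y ∧ c '' Set.Icc a b ⊆ S ∧ curveLength c a b = dist x y

/-- A curve `c : [a,b] → Y` is a local geodesic if around every interior parameter
there is a subinterval on which it is length minimising. -/
def IsLocalGeodesic (c : ℝ → Y) (a b : ℝ) : Prop :=
  ∀ t ∈ Set.Ioo a b, ∃ ε : ℝ, 0 < ε ∧ Set.Icc (t - ε) (t + ε) ⊆ Set.Icc a b ∧
    curveLength c (t - ε) (t + ε) = dist (c (t - ε)) (c (t + ε))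

/-- A closed set is weakly convex if any two of its points can be joined by a
local geodesic lying in the set. -/
def IsWeaklyConvex (S : Set Y) : Prop :=
  IsClosed S ∧ ∀ x ∈ S, ∀ y ∈ S, ∃ (a b : ℝ) (c : ℝ → Y) (K : NNReal), a ≤ b ∧
    LipschitzOnWith K c (Set.Icc a b) ∧ c a = x ∧ c b = y ∧
    c '' Set.Icc a b ⊆ S ∧ IsLocalGeodesic c a b

/-- A pointed closed convex set `(C,x)`: there is a constant `K ≥ 1` such that any
two points of `C ∩ B(x,r)` can be joined by a global geodesic inside `C ∩ B(x,Kr)`. -/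
def IsPointedClosedConvex (C : Set Y) (x : Y) : Prop :=
  x ∈ C ∧ IsClosedConvex C ∧ ∃ K : ℝ, 1 ≤ K ∧ ∀ r : ℝ, 0 < r →
    ∀ y ∈ C ∩ Metric.ball x r, ∀ y' ∈ C ∩ Metric.ball x r,
      JoinedByGeodesicIn (C ∩ Metric.ball x (K * r)) y y'

/-- The largest difference quotient of `f` over pairs of points of `s` at distance less than `ε`
from `u`. -/
def maxQuotient (f : ℝ → Y) (s : Set ℝ) (u ε : ℝ) : ℝ :=
  sSup ((fun p : ℝ × ℝ => dist (f p.1) (f p.2) / dist p.1 p.2) ''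
    {p : ℝ × ℝ | p.1 ∈ s ∧ p.2 ∈ s ∧ p.1 ≠ p.2 ∧ dist p.1 u < ε ∧ dist p.2 u < ε})

lemma dilatationOn_eq_limsup (f : ℝ → Y) (s : Set ℝ) (u : ℝ) :
    dilatationOn f s u = limsup (maxQuotient f s u) (𝓝[>] 0) := rfl

lemma maxQuotient_nonneg (f : ℝ → Y) (s : Set ℝ) (u ε : ℝ) : 0 ≤ maxQuotient f s u ε := by
  refine Real.sSup_nonneg ?_
  rintro _ ⟨p, -, rfl⟩
  positivity

section Lipschitz

variable {f : ℝ → Y} {s : Set ℝ} {K : NNReal}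

lemma LipschitzOnWith.quotient_le (hf : LipschitzOnWith K f s) {v w : ℝ} (hv : v ∈ s)
    (hw : w ∈ s) : dist (f v) (f w) / dist v w ≤ K :=
  div_le_of_le_mul₀ dist_nonneg K.coe_nonneg (hf.dist_le_mul v hv w hw)

lemma LipschitzOnWith.quotient_le_maxQuotient (hf : LipschitzOnWith K f s) {u ε v w : ℝ}
    (hv : v ∈ s) (hw : w ∈ s) (hvw : v ≠ w) (hvu : dist v u < ε) (hwu : dist w u < ε) :
    dist (f v) (f w) / dist v w ≤ maxQuotient f s u ε := by
  refine le_csSup ⟨K, ?_⟩ ⟨(v, w), ⟨hv, hw, hvw, hvu, hwu⟩, rfl⟩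
  rintro _ ⟨p, hp, rfl⟩
  exact hf.quotient_le hp.1 hp.2.1

lemma LipschitzOnWith.maxQuotient_le (hf : LipschitzOnWith K f s) (u ε : ℝ) :
    maxQuotient f s u ε ≤ K := by
  refine Real.sSup_le ?_ K.coe_nonneg
  rintro _ ⟨p, hp, rfl⟩
  exact hf.quotient_le hp.1 hp.2.1

lemma LipschitzOnWith.maxQuotient_le_maxQuotient (hf : LipschitzOnWith K f s) {u u' ε ε' : ℝ}
    (h : ε' + dist u' u ≤ ε) : maxQuotient f s u' ε' ≤ maxQuotient f s u ε := by
  refine Real.sSup_le ?_ (maxQuotient_nonneg f s u ε)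
  rintro _ ⟨p, ⟨h1, h2, hne, hp1, hp2⟩, rfl⟩
  refine hf.quotient_le_maxQuotient h1 h2 hne ?_ ?_
  · linarith [dist_triangle p.1 u' u]
  · linarith [dist_triangle p.2 u' u]

lemma LipschitzOnWith.isBoundedUnder_maxQuotient (hf : LipschitzOnWith K f s) (u : ℝ) :
    IsBoundedUnder (· ≤ ·) (𝓝[>] (0 : ℝ)) (maxQuotient f s u) :=
  isBoundedUnder_of ⟨K, hf.maxQuotient_le u⟩

lemma isCoboundedUnder_maxQuotient (f : ℝ → Y) (s : Set ℝ) (u : ℝ) :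
    IsCoboundedUnder (· ≤ ·) (𝓝[>] (0 : ℝ)) (maxQuotient f s u) :=
  (isBoundedUnder_of ⟨0, maxQuotient_nonneg f s u⟩ :
    IsBoundedUnder (· ≥ ·) (𝓝[>] (0 : ℝ)) (maxQuotient f s u)).isCoboundedUnder_le

lemma LipschitzOnWith.le_dilatationOn (hf : LipschitzOnWith K f s) {u m : ℝ}
    (h : ∀ ε > 0, m ≤ maxQuotient f s u ε) : m ≤ dilatationOn f s u := by
  rw [dilatationOn_eq_limsup]
  refine le_limsup_of_frequently_le (Eventually.frequently ?_) (hf.isBoundedUnder_maxQuotient u)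
  filter_upwards [self_mem_nhdsWithin] with ε hε using h ε hε

lemma LipschitzOnWith.dilatationOn_le (hf : LipschitzOnWith K f s) {u ε : ℝ} (hε : 0 < ε) :
    dilatationOn f s u ≤ maxQuotient f s u ε := by
  rw [dilatationOn_eq_limsup]
  refine limsup_le_of_le (isCoboundedUnder_maxQuotient f s u) ?_
  filter_upwards [Ioo_mem_nhdsGT hε] with ε' hε'
  exact hf.maxQuotient_le_maxQuotient (by simpa using hε'.2.le)

lemma LipschitzOnWith.upperSemicontinuous_dilatationOn (hf : LipschitzOnWith K f s) :
    UpperSemicontinuous (dilatationOn f s) := by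
  intro u α hα
  rw [dilatationOn_eq_limsup] at hα
  obtain ⟨ε, hε, hpos⟩ :=
    ((eventually_lt_of_limsup_lt hα (hf.isBoundedUnder_maxQuotient u)).and
      self_mem_nhdsWithin).exists
  have hpos : 0 < ε := hpos
  filter_upwards [Metric.ball_mem_nhds u (half_pos hpos)] with u' hu'
  rw [Metric.mem_ball] at hu'
  exact ((hf.dilatationOn_le (half_pos hpos)).trans
    (hf.maxQuotient_le_maxQuotient (by linarith))).trans_lt hε

lemma LipschitzOnWith.intervalIntegrable_dilatationOn (hf : LipschitzOnWith K f s) (a b : ℝ) :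
    IntervalIntegrable (dilatationOn f s) MeasureTheory.volume a b := by
  refine IntervalIntegrable.mono_fun (g := dilatationOn f s)
    (intervalIntegrable_const (c := (K : ℝ)))
    hf.upperSemicontinuous_dilatationOn.measurable.aestronglyMeasurable
    (Eventually.of_forall fun u => ?_)
  have h0 : 0 ≤ dilatationOn f s u := hf.le_dilatationOn fun ε _ => maxQuotient_nonneg f s u ε
  have h1 : dilatationOn f s u ≤ K :=
    (hf.dilatationOn_le one_pos).trans (hf.maxQuotient_le u 1)
  simpa only [Real.norm_of_nonneg h0, Real.norm_of_nonneg K.coe_nonneg] using h1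

end Lipschitz

lemma LipschitzOnWith.abs_deriv_dist_le_dilatationOn {c : ℝ → Y} {a b u : ℝ} {K : NNReal}
    (hc : LipschitzOnWith K c (Icc a b)) (p : Y) (hu : u ∈ Ioo a b) :
    |deriv (fun v => dist p (c v)) u| ≤ dilatationOn c (Icc a b) u := by
  refine hc.le_dilatationOn fun ε hε => ?_
  by_cases hd : DifferentiableAt ℝ (fun v => dist p (c v)) u
  · refine hd.hasDerivAt.le_of_lip' (maxQuotient_nonneg c _ u ε) ?_
    filter_upwards [Icc_mem_nhds hu.1 hu.2, Metric.ball_mem_nhds u hε] with v hv hvu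
    rcases eq_or_ne v u with rfl | hne
    · simp
    have hq := hc.quotient_le_maxQuotient hv (Ioo_subset_Icc_self hu) hne hvu
      (by simpa using hε)
    rw [div_le_iff₀ (dist_pos.2 hne)] at hq
    refine le_trans ?_ hq
    rw [Real.norm_eq_abs, dist_comm p, dist_comm p]
    exact abs_dist_sub_le _ _ _
  · rw [deriv_zero_of_not_differentiableAt hd, abs_zero]
    exact maxQuotient_nonneg c _ u ε

lemma LipschitzOnWith.dist_le_integral_dilatationOn {c : ℝ → Y} {a b s t : ℝ} {K : NNReal}
    (hc : LipschitzOnWith K c (Icc a b)) (has : a ≤ s) (hst : s ≤ t) (htb : t ≤ b) :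
    dist (c s) (c t) ≤ ∫ u in s..t, dilatationOn c (Icc a b) u := by
  have hg : LipschitzOnWith (1 * K) (fun v => dist (c s) (c v)) (uIcc s t) := by
    rw [uIcc_of_le hst]
    exact (LipschitzWith.dist_right (c s)).comp_lipschitzOnWith (hc.mono (Icc_subset_Icc has htb))
  have hac := hg.absolutelyContinuousOnInterval
  have hint := hac.integral_deriv_eq_sub
  simp only [dist_self, sub_zero] at hint
  rw [← hint]
  refine intervalIntegral.integral_mono_on_of_le_Ioo hst hac.intervalIntegrable_deriv
    (hc.intervalIntegrable_dilatationOn s t) fun u hu => ?_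
  exact (le_abs_self _).trans
    (hc.abs_deriv_dist_le_dilatationOn _ ⟨has.trans_lt hu.1, hu.2.trans_le htb⟩)

/-- A curve along which distances agree with differences of parameters. -/
def IsUnitSpeedGeodesicOn (c : ℝ → Y) (s : Set ℝ) : Prop :=
  ∀ ⦃t⦄, t ∈ s → ∀ ⦃t'⦄, t' ∈ s → dist (c t) (c t') = dist t t'

lemma JoinedByGeodesicIn.exists_unitSpeed {S : Set Y} {x y : Y} (h : JoinedByGeodesicIn S x y) :
    ∃ γ : ℝ → Y, γ 0 = x ∧ γ (dist x y) = y ∧ IsUnitSpeedGeodesicOn γ (Icc 0 (dist x y)) ∧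
      ∀ t ∈ Icc 0 (dist x y), γ t ∈ S := by
  obtain ⟨a, b, c, K, hab, hc, rfl, rfl, hS, hlen⟩ := h
  have hint := hc.intervalIntegrable_dilatationOn
  have key : ∀ s t, a ≤ s → s ≤ t → t ≤ b →
      dist (c s) (c t) = dist (c a) (c t) - dist (c a) (c s) := by
    intro s t has hst htb
    have h1 := hc.dist_le_integral_dilatationOn le_rfl has (hst.trans htb)
    have h2 := hc.dist_le_integral_dilatationOn has hst htb
    have h3 := hc.dist_le_integral_dilatationOn (has.trans hst) htb le_rfl
    have h4 := intervalIntegral.integral_add_adjacent_intervals (hint a s) (hint s t)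
    have h5 := intervalIntegral.integral_add_adjacent_intervals (hint a t) (hint t b)
    rw [curveLength] at hlen
    linarith [dist_triangle (c a) (c s) (c t), dist_triangle (c a) (c t) (c b)]
  have hcont : ContinuousOn (fun t => dist (c a) (c t)) (Icc a b) :=
    (continuous_const.dist continuous_id).comp_continuousOn hc.continuousOn
  have hivt : ∀ τ ∈ Icc 0 (dist (c a) (c b)), ∃ t ∈ Icc a b, dist (c a) (c t) = τ := by
    intro τ hτ
    have := intermediate_value_Icc hab hcont
    rw [dist_self] at this
    exact this hτ
  choose! σ hσ hστ using hivt
  have h0 : (0 : ℝ) ∈ Icc 0 (dist (c a) (c b)) := ⟨le_rfl, dist_nonneg⟩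
  have h1 : dist (c a) (c b) ∈ Icc 0 (dist (c a) (c b)) := ⟨dist_nonneg, le_rfl⟩
  refine ⟨c ∘ σ, (dist_eq_zero.1 (hστ 0 h0)).symm, ?_, ?_, fun t ht => hS ⟨σ t, hσ t ht, rfl⟩⟩
  · have := key _ b (hσ _ h1).1 (hσ _ h1).2 le_rfl
    rw [hστ _ h1, sub_self] at this
    exact dist_eq_zero.1 this
  · intro τ hτ τ' hτ'
    simp only [Function.comp]
    rcases le_total (σ τ) (σ τ') with hle | hle
    · have hd := key _ _ (hσ τ hτ).1 hle (hσ τ' hτ').2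
      rw [hστ τ hτ, hστ τ' hτ'] at hd
      rw [hd, dist_comm τ, Real.dist_eq, abs_of_nonneg (hd ▸ dist_nonneg)]
    · have hd := key _ _ (hσ τ' hτ').1 hle (hσ τ hτ).2
      rw [hστ τ hτ, hστ τ' hτ'] at hd
      rw [dist_comm, hd, Real.dist_eq, abs_of_nonneg (hd ▸ dist_nonneg)]

lemma IsUnitSpeedGeodesicOn.curveLength_eq {c : ℝ → Y} {a b : ℝ} (hab : a < b)
    (hc : IsUnitSpeedGeodesicOn c (Icc a b)) : curveLength c a b = dist (c a) (c b) := by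
  have hlip : LipschitzOnWith 1 c (Icc a b) :=
    LipschitzOnWith.of_dist_le_mul fun x hx y hy => by simpa using (hc hx hy).le
  have hdil : ∀ u ∈ uIcc a b, dilatationOn c (Icc a b) u = 1 := by
    intro u hu
    rw [uIcc_of_le hab.le] at hu
    refine le_antisymm ((hlip.dilatationOn_le one_pos).trans (hlip.maxQuotient_le u 1))
      (hlip.le_dilatationOn fun ε hε => ?_)
    obtain ⟨v, hv, hvu, hne⟩ : ∃ v ∈ Icc a b, dist v u < ε ∧ v ≠ u := by
      rcases lt_or_ge u b with hub | hub
      · refine ⟨min b (u + ε / 2), ⟨?_, min_le_left _ _⟩, ?_, ?_⟩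
        · exact le_min hab.le (by linarith [hu.1])
        · have h1 : u < min b (u + ε / 2) := lt_min hub (by linarith)
          rw [Real.dist_eq, abs_of_pos (by linarith)]
          linarith [min_le_right b (u + ε / 2)]
        · exact (lt_min hub (by linarith)).ne'
      · refine ⟨max a (u - ε / 2), ⟨le_max_left _ _, ?_⟩, ?_, ?_⟩
        · exact max_le hab.le (by linarith [hu.2])
        · have h1 : max a (u - ε / 2) < u := max_lt (hab.trans_le hub) (by linarith)
          rw [Real.dist_eq, abs_of_neg (by linarith)]
          linarith [le_max_right a (u - ε / 2)]
        · exact (max_lt (hab.trans_le hub) (by linarith)).ne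
    have := hlip.quotient_le_maxQuotient hv hu hne hvu (by simpa using hε)
    rwa [hc hv hu, div_self (dist_pos.2 hne).ne'] at this
  rw [curveLength, intervalIntegral.integral_congr hdil, hc (left_mem_Icc.2 hab.le)
    (right_mem_Icc.2 hab.le), dist_comm, Real.dist_eq, abs_of_pos (sub_pos.2 hab)]
  simp

section Curves

variable {X : Type*} [TopologicalSpace X] {f : X → Y}

/-- `x` and `y` are joined by a continuous curve in `X`, parametrised by `[0, L]`, whose image
under `f` is `1`-Lipschitz. -/
def JoinedByCurve (f : X → Y) (x y : X) (L : ℝ) : Prop :=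
  0 ≤ L ∧ ∃ c : ℝ → X, Continuous c ∧ LipschitzWith 1 (f ∘ c) ∧
    (∀ t ≤ 0, c t = x) ∧ ∀ t, L ≤ t → c t = y

lemma joinedByCurve_of_lipschitz {c : ℝ → X} (hc : Continuous c) (hfc : LipschitzWith 1 (f ∘ c))
    {a b : ℝ} (hab : a ≤ b) : JoinedByCurve f (c a) (c b) (b - a) := by
  have hclamp : LipschitzWith 1 fun t : ℝ => max a (min b (a + t)) := by
    refine LipschitzWith.const_max (LipschitzWith.const_min ?_ b) a
    exact LipschitzWith.of_dist_le_mul fun x y => by simp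
  refine ⟨sub_nonneg.2 hab, fun t => c (max a (min b (a + t))), hc.comp hclamp.continuous, ?_,
    fun t ht => ?_, fun t ht => ?_⟩
  · have := hfc.comp hclamp
    rwa [mul_one] at this
  · have h1 : min b (a + t) ≤ a := (min_le_right _ _).trans (by linarith)
    simp only [max_eq_left h1]
  · have h1 : b ≤ a + t := by linarith
    simp only [min_eq_left h1, max_eq_right hab]

lemma JoinedByCurve.refl (x : X) : JoinedByCurve f x x 0 :=
  ⟨le_rfl, fun _ => x, continuous_const, LipschitzWith.const' _, fun _ _ => rfl, fun _ _ => rfl⟩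

lemma JoinedByCurve.trans {x y z : X} {L M : ℝ} (h₁ : JoinedByCurve f x y L)
    (h₂ : JoinedByCurve f y z M) : JoinedByCurve f x z (L + M) := by
  obtain ⟨hL, c, hc, hfc, hc0, hcL⟩ := h₁
  obtain ⟨hM, d, hd, hfd, hd0, hdM⟩ := h₂
  set e : ℝ → X := fun t => if t ≤ L then c t else d (t - L)
  have he1 : ∀ t, t ≤ L → e t = c t := fun t ht => if_pos ht
  have he2 : ∀ t, L ≤ t → e t = d (t - L) := by
    intro t ht
    rcases ht.eq_or_lt with rfl | ht
    · rw [he1 _ le_rfl, hcL _ le_rfl, hd0 _ (by simp)]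
    · exact if_neg ht.not_ge
  have hle : ∀ s t, s ≤ t → dist (f (e s)) (f (e t)) ≤ t - s := by
    have hc' : ∀ s t, s ≤ t → dist (f (c s)) (f (c t)) ≤ t - s := fun s t hst => by
      simpa [dist_comm s, Real.dist_eq, abs_of_nonneg (sub_nonneg.2 hst)] using
        hfc.dist_le_mul s t
    have hd' : ∀ s t, s ≤ t → dist (f (d s)) (f (d t)) ≤ t - s := fun s t hst => by
      simpa [dist_comm s, Real.dist_eq, abs_of_nonneg (sub_nonneg.2 hst)] using
        hfd.dist_le_mul s t
    intro s t hst
    rcases le_total t L with ht | ht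
    · rw [he1 s (hst.trans ht), he1 t ht]
      exact hc' s t hst
    rcases le_total s L with hs | hs
    · have h1 := hc' s L hs
      have h2 := hd' (L - L) (t - L) (by linarith)
      rw [← he2 L le_rfl, ← he2 t ht] at h2
      rw [← he1 s hs, ← he1 L le_rfl] at h1
      linarith [dist_triangle (f (e s)) (f (e L)) (f (e t))]
    · rw [he2 s hs, he2 t ht]
      have := hd' (s - L) (t - L) (by linarith)
      linarith
  refine ⟨add_nonneg hL hM, e, ?_, ?_, fun t ht => ?_, fun t ht => ?_⟩
  · refine Continuous.if_le hc (hd.comp (continuous_id.sub continuous_const)) continuous_id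
      continuous_const ?_
    rintro t rfl
    rw [hcL _ le_rfl, hd0 _ (by simp)]
  · refine LipschitzWith.of_dist_le_mul fun s t => ?_
    rw [NNReal.coe_one, one_mul]
    rcases le_total s t with h | h
    · rw [dist_comm s, Real.dist_eq, abs_of_nonneg (sub_nonneg.2 h)]
      exact hle s t h
    · rw [dist_comm, Real.dist_eq, abs_of_nonneg (sub_nonneg.2 h)]
      exact hle t s h
  · rw [he1 t (ht.trans hL), hc0 t ht]
  · rw [he2 t (by linarith), hdM _ (by linarith)]

end Curves

section Chains

variable {X ι : Type*} {f : X → Y} {S : ι → Set X}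

/-- Each of the first `n` steps of the sequence `u` stays within a member of the family `S`. -/
def IsChainOf (S : ι → Set X) (n : ℕ) (u : ℕ → X) : Prop :=
  ∀ k < n, ∃ i, u k ∈ S i ∧ u (k + 1) ∈ S i

/-- The total length of the jumps of the image under `f` of the first `n` steps of `u`. -/
def chainCost (f : X → Y) (n : ℕ) (u : ℕ → X) : ℝ :=
  ∑ k ∈ Finset.range n, dist (f (u k)) (f (u (k + 1)))

lemma IsChainOf.exists_shorter [Fintype ι] {n : ℕ} {u : ℕ → X} (hu : IsChainOf S n u)
    (hn : Fintype.card ι < n) : ∃ n' < n, ∃ v, IsChainOf S n' v ∧ v 0 = u 0 ∧ v n' = u n ∧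
      chainCost f n' v ≤ chainCost f n u := by
  have : Nonempty ι := (hu 0 (Nat.zero_lt_of_lt hn)).nonempty
  choose! σ hσ hσ' using hu
  obtain ⟨a, b, hab, hs⟩ : ∃ a b : Fin n, a < b ∧ σ a = σ b := by
    obtain ⟨a, b, hne, hs⟩ :=
      Fintype.exists_ne_map_eq_of_card_lt (fun k : Fin n => σ k) (by simpa using hn)
    rcases hne.lt_or_gt with h | h
    · exact ⟨a, b, h, hs⟩
    · exact ⟨b, a, h, hs.symm⟩
  obtain ⟨i, hi⟩ := a
  obtain ⟨j, hj⟩ := b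
  simp only [Fin.mk_lt_mk] at hab hs
  obtain ⟨d, rfl⟩ := Nat.exists_eq_add_of_lt hab
  obtain ⟨m, rfl⟩ := Nat.exists_eq_add_of_lt hj
  set v : ℕ → X := fun k => if k ≤ i then u k else u (k + (d + 1))
  have hv1 : ∀ k ≤ i, v k = u k := fun k hk => if_pos hk
  have hv2 : ∀ k, i < k → v k = u (k + (d + 1)) := fun k hk => if_neg hk.not_ge
  refine ⟨i + 1 + m, by omega, v, ?_, hv1 0 (Nat.zero_le _), ?_, ?_⟩
  · intro k hk
    rcases lt_trichotomy k i with h | rfl | h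
    · rw [hv1 k h.le, hv1 (k + 1) h]
      exact ⟨σ k, hσ k (by omega), hσ' k (by omega)⟩
    · rw [hv1 k le_rfl, hv2 (k + 1) (by omega)]
      refine ⟨σ k, hσ k (by omega), ?_⟩
      rw [hs, show k + 1 + (d + 1) = k + d + 1 + 1 by omega]
      exact hσ' _ hj
    · rw [hv2 k h, hv2 (k + 1) (by omega), show k + 1 + (d + 1) = k + (d + 1) + 1 by omega]
      exact ⟨_, hσ _ (by omega), hσ' _ (by omega)⟩
  · rw [hv2 _ (by omega)]
    congr 1
    omega
  · have e1 : chainCost f (i + 1 + m) v = ∑ k ∈ Finset.range i, dist (f (u k)) (f (u (k + 1))) +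
        dist (f (u i)) (f (u (i + (d + 1) + 1))) +
        ∑ k ∈ Finset.range m, dist (f (u (i + (d + 1) + 1 + k)))
          (f (u (i + (d + 1) + 1 + k + 1))) := by
      rw [chainCost, Finset.sum_range_add, Finset.sum_range_succ]
      congr 1
      · congr 1
        · refine Finset.sum_congr rfl fun k hk => ?_
          have := Finset.mem_range.1 hk
          rw [hv1 k this.le, hv1 (k + 1) this]
        · rw [hv1 i le_rfl, hv2 (i + 1) (by omega),
            show i + 1 + (d + 1) = i + (d + 1) + 1 by omega]
      · refine Finset.sum_congr rfl fun k _ => ?_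
        rw [hv2 _ (by omega), hv2 _ (by omega)]
        congr 3 <;> omega
    have e2 : chainCost f (i + d + 1 + m + 1) u =
        ∑ k ∈ Finset.range i, dist (f (u k)) (f (u (k + 1))) +
        ∑ k ∈ Finset.range (d + 2), dist (f (u (i + k))) (f (u (i + k + 1))) +
        ∑ k ∈ Finset.range m, dist (f (u (i + (d + 1) + 1 + k)))
          (f (u (i + (d + 1) + 1 + k + 1))) := by
      rw [chainCost, show i + d + 1 + m + 1 = i + (d + 2) + m by omega, Finset.sum_range_add,
        Finset.sum_range_add]
      rfl
    have e3 := dist_le_range_sum_dist (fun k => f (u (i + k))) (d + 2)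
    rw [e1, e2]
    simp only [add_zero] at e3
    have e4 : i + (d + 1) + 1 = i + (d + 2) := by omega
    rw [e4]
    simp only [← add_assoc] at e3 ⊢
    linarith

lemma IsChainOf.exists_length_le [Fintype ι] {n : ℕ} {u : ℕ → X} (hu : IsChainOf S n u) :
    ∃ n' ≤ Fintype.card ι, ∃ v, IsChainOf S n' v ∧ v 0 = u 0 ∧ v n' = u n ∧
      chainCost f n' v ≤ chainCost f n u := by
  induction n using Nat.strong_induction_on generalizing u with
  | _ n ih =>
    rcases le_or_gt n (Fintype.card ι) with hn | hn
    · exact ⟨n, hn, u, hu, rfl, rfl, le_rfl⟩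
    · obtain ⟨n', hn', v, hv, hv0, hvn, hcost⟩ := hu.exists_shorter (f := f) hn
      obtain ⟨k, hk, w, hw, hw0, hwk, hcost'⟩ := ih n' hn' hv
      exact ⟨k, hk, w, hw, hw0.trans hv0, hwk.trans hvn, hcost'.trans hcost⟩

lemma IsChainOf.exists_length_eq (hS : ∀ x, ∃ i, x ∈ S i) {n m : ℕ} {u : ℕ → X}
    (hu : IsChainOf S n u) (hnm : n ≤ m) : ∃ v, IsChainOf S m v ∧ v 0 = u 0 ∧ v m = u n ∧
      chainCost f m v = chainCost f n u := by
  refine ⟨fun k => u (min k n), fun k _ => ?_, by simp, by simp [hnm], ?_⟩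
  · dsimp only
    rcases lt_or_ge k n with h | h
    · rw [min_eq_left h.le, min_eq_left (Nat.succ_le_of_lt h)]
      exact hu k h
    · rw [min_eq_right h, min_eq_right (h.trans (Nat.le_succ k))]
      exact (hS _).imp fun i hi => ⟨hi, hi⟩
  · obtain ⟨d, rfl⟩ := Nat.exists_eq_add_of_le hnm
    rw [chainCost, Finset.sum_range_add, chainCost]
    have : ∀ k ∈ Finset.range n, dist (f (u (min k n))) (f (u (min (k + 1) n))) =
        dist (f (u k)) (f (u (k + 1))) := fun k hk => by
      have := Finset.mem_range.1 hk
      rw [min_eq_left this.le, min_eq_left this]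
    rw [Finset.sum_congr rfl this, add_eq_left]
    refine Finset.sum_eq_zero fun k _ => ?_
    rw [min_eq_right (by omega), min_eq_right (by omega), dist_self]

variable [TopologicalSpace X]

lemma IsChainOf.joinedByCurve
    (hS : ∀ i, ∀ y ∈ S i, ∀ z ∈ S i, JoinedByCurve f y z (dist (f y) (f z))) {n : ℕ} {u : ℕ → X}
    (hu : IsChainOf S n u) : JoinedByCurve f (u 0) (u n) (chainCost f n u) := by
  induction n with
  | zero => simpa [chainCost] using JoinedByCurve.refl (u 0)
  | succ n ih =>
    obtain ⟨i, hi, hi'⟩ := hu n n.lt_succ_self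
    rw [chainCost, Finset.sum_range_succ]
    exact (ih fun k hk => hu k (hk.trans n.lt_succ_self)).trans (hS i _ hi _ hi')

lemma JoinedByCurve.exists_chain (hS : ∀ x, ∃ i, S i ∈ 𝓝 x) {x y : X} {L : ℝ}
    (h : JoinedByCurve f x y L) :
    ∃ n u, IsChainOf S n u ∧ u 0 = x ∧ u n = y ∧ chainCost f n u ≤ L := by
  obtain ⟨hL, c, hc, hfc, hc0, hcL⟩ := h
  obtain ⟨t, ht0, htm, ⟨m, hm⟩, hti⟩ := exists_monotone_Icc_subset_open_cover_Icc hL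
    (c := fun i => (fun s : Icc 0 L => c s) ⁻¹' interior (S i))
    (fun i => isOpen_interior.preimage (hc.comp continuous_subtype_val)) fun s _ => by
      obtain ⟨i, hi⟩ := hS (c s)
      exact mem_iUnion.2 ⟨i, mem_interior_iff_mem_nhds.2 hi⟩
  refine ⟨m, fun k => c (t k), fun k _ => ?_, ?_, ?_, ?_⟩
  · obtain ⟨i, hi⟩ := hti k
    have hle := htm k.le_succ
    exact ⟨i, interior_subset (hi (left_mem_Icc.2 hle)), interior_subset (hi (right_mem_Icc.2 hle))⟩
  · exact hc0 _ (by rw [ht0])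
  · exact hcL _ (by rw [hm m le_rfl])
  · have hstep : ∀ k ∈ Finset.range m, dist (f (c (t k))) (f (c (t (k + 1)))) ≤
        (t (k + 1) : ℝ) - t k := fun k _ => by
      have hle : (t k : ℝ) ≤ t (k + 1) := htm k.le_succ
      have := hfc.dist_le_mul (t k) (t (k + 1))
      rwa [NNReal.coe_one, one_mul, dist_comm (t k : ℝ), Real.dist_eq,
        abs_of_nonneg (sub_nonneg.2 hle)] at this
    refine (Finset.sum_le_sum hstep).trans ?_
    rw [Finset.sum_range_sub (fun k => (t k : ℝ)), hm m le_rfl, ht0]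
    simp

lemma isClosed_setOf_isChainOf [Finite ι] (hS : ∀ i, IsClosed (S i)) (n : ℕ) :
    IsClosed {u : ℕ → X | IsChainOf S n u} := by
  simp only [IsChainOf, ofPred_forall, ofPred_exists]
  refine isClosed_iInter fun k => isClosed_iInter fun _ => isClosed_iUnion_of_finite fun i => ?_
  exact ((hS i).preimage (continuous_apply k)).inter ((hS i).preimage (continuous_apply (k + 1)))

end Chains

section LocalToGlobal

variable {X : Type*} [TopologicalSpace X] [CompactSpace X] [T2Space X] {f : X → Y}

lemma exists_finite_closed_cover
    (hloc : ∀ x, ∃ S ∈ 𝓝 x, ∀ y ∈ S, ∀ z ∈ S, JoinedByCurve f y z (dist (f y) (f z))) :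
    ∃ (t : Finset X) (S : t → Set X), (∀ i, IsClosed (S i)) ∧ (∀ x, ∃ i, S i ∈ 𝓝 x) ∧
      ∀ i, ∀ y ∈ S i, ∀ z ∈ S i, JoinedByCurve f y z (dist (f y) (f z)) := by
  choose S hS hcurve using hloc
  choose T hT hTclosed hTS using fun x => exists_mem_nhds_isClosed_subset (hS x)
  obtain ⟨t, ht⟩ := CompactSpace.elim_nhds_subcover (fun x => interior (T x))
    fun x => interior_mem_nhds.2 (hT x)
  refine ⟨t, fun i => T i, fun i => hTclosed i, fun x => ?_, fun i y hy z hz =>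
    hcurve i y (hTS i hy) z (hTS i hz)⟩
  have hx : x ∈ ⋃ z ∈ t, interior (T z) := by rw [ht]; trivial
  obtain ⟨z, hz, hxz⟩ := mem_iUnion₂.1 hx
  exact ⟨⟨z, hz⟩, mem_interior_iff_mem_nhds.1 hxz⟩

lemma exists_shortest_joinedByCurve [ConnectedSpace X] (hf : Continuous f)
    (hloc : ∀ x, ∃ S ∈ 𝓝 x, ∀ y ∈ S, ∀ z ∈ S, JoinedByCurve f y z (dist (f y) (f z)))
    (x y : X) : ∃ L, JoinedByCurve f x y L ∧ ∀ L', JoinedByCurve f x y L' → L ≤ L' := by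
  obtain ⟨t, S, hclosed, hnhds, hcurve⟩ := exists_finite_closed_cover hloc
  have hmem : ∀ x, ∃ i, x ∈ S i := fun x => (hnhds x).imp fun i hi => mem_of_mem_nhds hi
  set m := Fintype.card t
  have hred : ∀ L, JoinedByCurve f x y L →
      ∃ v, (IsChainOf S m v ∧ v 0 = x ∧ v m = y) ∧ chainCost f m v ≤ L := by
    intro L hL
    obtain ⟨n, u, hu, hu0, hun, hcost⟩ := hL.exists_chain hnhds
    obtain ⟨n', hn', v, hv, hv0, hvn, hcost'⟩ := hu.exists_length_le (f := f)
    obtain ⟨w, hw, hw0, hwm, hcost''⟩ := hv.exists_length_eq (f := f) hmem hn'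
    exact ⟨w, ⟨hw, hw0.trans (hv0.trans hu0), hwm.trans (hvn.trans hun)⟩,
      (hcost''.le.trans hcost').trans hcost⟩
  obtain ⟨L₀, hL₀⟩ : ∃ L, JoinedByCurve f x y L := by
    refine PreconnectedSpace.induction₂' (fun x y => ∃ L, JoinedByCurve f x y L) (fun x => ?_)
      ⟨fun a b c ⟨L, hL⟩ ⟨M, hM⟩ => ⟨L + M, hL.trans hM⟩⟩ x y
    obtain ⟨T, hT, hjoin⟩ := hloc x
    filter_upwards [hT] with z hz
    exact ⟨⟨_, hjoin x (mem_of_mem_nhds hT) z hz⟩, ⟨_, hjoin z hz x (mem_of_mem_nhds hT)⟩⟩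
  have hcompact : IsCompact {u : ℕ → X | IsChainOf S m u ∧ u 0 = x ∧ u m = y} := by
    refine IsClosed.isCompact ((isClosed_setOf_isChainOf hclosed m).inter (IsClosed.inter ?_ ?_))
    · exact isClosed_singleton.preimage (continuous_apply 0)
    · exact isClosed_singleton.preimage (continuous_apply m)
  have hcont : Continuous (chainCost f m) := by
    unfold chainCost
    fun_prop
  obtain ⟨v₀, hv₀, -⟩ := hred L₀ hL₀
  obtain ⟨u, ⟨hu, hu0, hum⟩, hmin⟩ := hcompact.exists_isMinOn ⟨v₀, hv₀⟩ hcont.continuousOn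
  refine ⟨chainCost f m u, ?_, fun L' hL' => ?_⟩
  · have := hu.joinedByCurve hcurve
    rwa [hu0, hum] at this
  · obtain ⟨v, hv, hcost⟩ := hred L' hL'
    exact (hmin hv).trans hcost

lemma exists_locally_unitSpeed_curve [ConnectedSpace X] (hf : Continuous f)
    (hloc : ∀ x, ∃ S ∈ 𝓝 x, ∀ y ∈ S, ∀ z ∈ S, JoinedByCurve f y z (dist (f y) (f z)))
    (x y : X) : ∃ (L : ℝ) (c : ℝ → X), 0 ≤ L ∧ LipschitzWith 1 (f ∘ c) ∧ c 0 = x ∧ c L = y ∧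
      ∀ t ∈ Ioo 0 L, ∃ ε > 0, Icc (t - ε) (t + ε) ⊆ Icc 0 L ∧
        IsUnitSpeedGeodesicOn (f ∘ c) (Icc (t - ε) (t + ε)) := by
  obtain ⟨L, ⟨hL, c, hc, hfc, hc0, hcL⟩, hmin⟩ := exists_shortest_joinedByCurve hf hloc x y
  refine ⟨L, c, hL, hfc, hc0 0 le_rfl, hcL L le_rfl, fun t ht => ?_⟩
  obtain ⟨S, hS, hjoin⟩ := hloc (c t)
  obtain ⟨ε, hε, hball⟩ := Metric.nhds_basis_closedBall.mem_iff.1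
    (inter_mem (hc.continuousAt hS) (Icc_mem_nhds ht.1 ht.2))
  rw [Real.closedBall_eq_Icc] at hball
  refine ⟨ε, hε, fun s hs => (hball hs).2, ?_⟩
  have hge : ∀ s ∈ Icc (t - ε) (t + ε), ∀ s' ∈ Icc (t - ε) (t + ε), s ≤ s' →
      dist (f (c s)) (f (c s')) = s' - s := by
    intro s hs s' hs' hss
    have h1 := joinedByCurve_of_lipschitz hc hfc (hball hs).2.1
    have h2 := joinedByCurve_of_lipschitz hc hfc (hball hs').2.2
    rw [hc0 0 le_rfl] at h1
    rw [hcL L le_rfl] at h2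
    have h3 := hmin _ ((h1.trans (hjoin _ (hball hs).1 _ (hball hs').1)).trans h2)
    have h4 := hfc.dist_le_mul s s'
    rw [NNReal.coe_one, one_mul, dist_comm s, Real.dist_eq,
      abs_of_nonneg (sub_nonneg.2 hss)] at h4
    simp only [Function.comp] at h4
    linarith
  intro s hs s' hs'
  simp only [Function.comp]
  rcases le_total s s' with h | h
  · rw [hge s hs s' hs' h, dist_comm, Real.dist_eq, abs_of_nonneg (sub_nonneg.2 h)]
  · rw [dist_comm, hge s' hs' s hs h, Real.dist_eq, abs_of_nonneg (sub_nonneg.2 h)]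

end LocalToGlobal

section LocalInjectivity

variable {X : Type*} [TopologicalSpace X] {f : X → Y}

/-- Every open subset of `N` has an image under `f` that is relatively open in `C`. -/
def IsOpenInto (f : X → Y) (N : Set X) (C : Set Y) : Prop :=
  ∀ U : Set X, IsOpen U → U ⊆ N → ∃ W : Set Y, IsOpen W ∧ f '' U = W ∩ C

lemma exists_nhds_joinedByCurve (hf : Continuous f) {x : X} {N : Set X} {C : Set Y}
    (hN : IsOpen N) (hx : x ∈ N) (hinj : InjOn f N) (hC : IsPointedClosedConvex C (f x))
    (hopen : IsOpenInto f N C) :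
    ∃ S ∈ 𝓝 x, ∀ y ∈ S, ∀ z ∈ S, JoinedByCurve f y z (dist (f y) (f z)) := by
  obtain ⟨-, -, K, hK, hgeo⟩ := hC
  obtain ⟨W, hW, hfN⟩ := hopen N hN subset_rfl
  have hsub : ∀ y ∈ N, f y ∈ W ∧ f y ∈ C := fun y hy =>
    (hfN ▸ mem_image_of_mem f hy : f y ∈ W ∩ C)
  obtain ⟨ρ, hρ, hball⟩ := Metric.isOpen_iff.1 hW _ (hsub x hx).1
  have hK0 : 0 < K := one_pos.trans_le hK
  refine ⟨N ∩ f ⁻¹' Metric.ball (f x) (ρ / K), inter_mem (hN.mem_nhds hx)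
    (hf.continuousAt (Metric.ball_mem_nhds _ (div_pos hρ hK0))), fun y hy z hz => ?_⟩
  obtain ⟨γ, hγ0, hγd, hγ, hγC⟩ := (hgeo (ρ / K) (div_pos hρ hK0) (f y)
    ⟨(hsub y hy.1).2, hy.2⟩ (f z) ⟨(hsub z hz.1).2, hz.2⟩).exists_unitSpeed
  rw [mul_div_cancel₀ _ hK0.ne'] at hγC
  set d := dist (f y) (f z)
  have hd : 0 ≤ d := dist_nonneg
  set p : ℝ → ℝ := fun τ => max 0 (min d τ)
  have hp : LipschitzWith 1 p := (LipschitzWith.id.const_min d).const_max 0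
  have hpmem : ∀ τ, p τ ∈ Icc 0 d := fun τ => ⟨le_max_left _ _, max_le hd (min_le_left _ _)⟩
  have hlift : ∀ τ, ∃ w ∈ N, f w = γ (p τ) := fun τ => by
    have : γ (p τ) ∈ f '' N := hfN ▸ ⟨hball (hγC _ (hpmem τ)).2, (hγC _ (hpmem τ)).1⟩
    exact this
  choose c hcN hfc using hlift
  have hlip : LipschitzWith 1 (f ∘ c) := LipschitzWith.of_dist_le_mul fun s t => by
    simp only [Function.comp, hfc]
    rw [hγ (hpmem s) (hpmem t)]
    exact hp.dist_le_mul s t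
  refine ⟨hd, c, continuous_iff_continuousAt.2 fun τ => ?_, hlip, fun τ hτ => ?_, fun τ hτ => ?_⟩
  · intro V hV
    rw [mem_map]
    obtain ⟨U, hUV, hU, hτU⟩ := mem_nhds_iff.1 (inter_mem hV (hN.mem_nhds (hcN τ)))
    obtain ⟨W', hW', hfU⟩ := hopen U hU (hUV.trans inter_subset_right)
    have hmem : f (c τ) ∈ W' ∩ C := hfU ▸ mem_image_of_mem f hτU
    filter_upwards [hlip.continuous.continuousAt (hW'.mem_nhds hmem.1)] with τ' hτ'
    have : f (c τ') ∈ f '' U := hfU ▸ ⟨hτ', (hsub _ (hcN τ')).2⟩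
    obtain ⟨w, hwU, hw⟩ := this
    have hwc : w = c τ' := hinj (hUV hwU).2 (hcN τ') hw
    rw [mem_preimage, ← hwc]
    exact (hUV hwU).1
  · refine hinj (hcN τ) hy.1 ?_
    rw [hfc, show p τ = 0 from max_eq_left ((min_le_right _ _).trans hτ), hγ0]
  · refine hinj (hcN τ) hz.1 ?_
    rw [hfc, show p τ = d by simp only [p, min_eq_left hτ, max_eq_right hd], hγd]

end LocalInjectivity

section FiberComponents

variable {X : Type*} [TopologicalSpace X] {f : X → Y}

/-- Two points are equivalent when they lie in the same connected component of a fibre of `f`. -/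
def fiberComponentSetoid (f : X → Y) : Setoid X where
  r x y := y ∈ connectedComponentIn (f ⁻¹' {f x}) x
  iseqv := by
    have hfib : ∀ {x y : X}, y ∈ connectedComponentIn (f ⁻¹' {f x}) x → f y = f x :=
      fun {x _} h => connectedComponentIn_subset (f ⁻¹' {f x}) x h
    refine ⟨fun x => mem_connectedComponentIn rfl, fun {x y} h => ?_, fun {x y z} h h' => ?_⟩
    · rw [hfib h, ← connectedComponentIn_eq h]
      exact mem_connectedComponentIn rfl
    · rwa [hfib h, ← connectedComponentIn_eq h] at h'

lemma fiberComponent_map_eq {Z : Type*} {f : X → Z} {x y : X}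
    (h : fiberComponentSetoid f x y) : f x = f y :=
  (connectedComponentIn_subset (f ⁻¹' {f x}) x h : y ∈ f ⁻¹' {f x}).symm

lemma fiberComponent_of_isPreconnected {Z : Type*} {f : X → Z} {x y : X} {T : Set X}
    (hT : IsPreconnected T) (hTf : T ⊆ f ⁻¹' {f x}) (hx : x ∈ T) (hy : y ∈ T) :
    fiberComponentSetoid f x y :=
  hT.subset_connectedComponentIn hx hTf hy

/-- The map induced by `f` on the space of connected components of its fibres. -/
def fiberComponentLift (f : X → Y) : Quotient (fiberComponentSetoid f) → Y :=
  Quotient.lift f fun _ _ h => fiberComponent_map_eq h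

lemma continuous_fiberComponentLift (hf : Continuous f) : Continuous (fiberComponentLift f) :=
  hf.quotient_lift _

/-- Near every point the fibres of `f` are connected and `f` is open into a pointed closed convex
set. -/
def LocallyOpenConnectedFibers (f : X → Y) : Prop :=
  ∀ x, ∃ (N : Set X) (C : Set Y), IsOpen N ∧ x ∈ N ∧
    (∀ y ∈ N, ∀ z ∈ N, f y = f z → fiberComponentSetoid f y z) ∧
    IsPointedClosedConvex C (f x) ∧ IsOpenInto f N C

lemma LocallyOpenConnectedFibers.isOpenMap_mk (hloc : LocallyOpenConnectedFibers f)
    (hf : Continuous f) : IsOpenMap (Quotient.mk (fiberComponentSetoid f)) := by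
  intro U hU
  set A : Set X := {y | ∃ u ∈ U, fiberComponentSetoid f u y}
  have hAeq : Quotient.mk (fiberComponentSetoid f) ⁻¹'
      (Quotient.mk (fiberComponentSetoid f) '' U) = A := by
    ext y
    exact exists_congr fun u => and_congr_right fun _ => Quotient.eq
  rw [← isQuotientMap_quotient_mk'.isOpen_preimage]
  change IsOpen (Quotient.mk (fiberComponentSetoid f) ⁻¹' _)
  rw [hAeq, isOpen_iff_mem_nhds]
  rintro y ⟨u, huU, huy⟩
  have hUA : U ⊆ A := fun v hv => ⟨v, hv, Setoid.refl' _ v⟩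
  set E := connectedComponentIn (f ⁻¹' {f u}) u
  have hstep : ∀ x ∈ E, ∃ N, IsOpen N ∧ x ∈ N ∧
      ∀ v ∈ E ∩ N, ∀ w ∈ E ∩ N, A ∈ 𝓝 v → A ∈ 𝓝 w := by
    intro x hx
    obtain ⟨N, C, hN, hxN, hconn, hC, hopen⟩ := hloc x
    refine ⟨N, hN, hxN, fun v hv w hw hAv => ?_⟩
    obtain ⟨O, hOA, hO, hvO⟩ := mem_nhds_iff.1 (inter_mem hAv (hN.mem_nhds hv.2))
    obtain ⟨W, hW, hfO⟩ := hopen O hO (hOA.trans inter_subset_right)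
    obtain ⟨W', -, hfN⟩ := hopen N hN subset_rfl
    have hvw : f v = f w :=
      Eq.trans (connectedComponentIn_subset (f ⁻¹' {f u}) u hv.1)
        (Eq.symm (connectedComponentIn_subset (f ⁻¹' {f u}) u hw.1))
    have hmem : f v ∈ W ∩ C := hfO ▸ mem_image_of_mem f hvO
    filter_upwards [hN.mem_nhds hw.2, hf.continuousAt (hW.mem_nhds (hvw ▸ hmem.1))] with z hzN hzW
    have hzC : f z ∈ W' ∩ C := hfN ▸ mem_image_of_mem f hzN
    have : f z ∈ f '' O := hfO ▸ ⟨hzW, hzC.2⟩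
    obtain ⟨o, hoO, ho⟩ := this
    obtain ⟨u', hu'U, hu'⟩ := (hOA hoO).1
    exact ⟨u', hu'U, Setoid.trans' _ hu' (hconn o (hOA hoO).2 z hzN ho)⟩
  have hind := isPreconnected_connectedComponentIn.induction₂ (s := E)
    (fun v w => A ∈ 𝓝 v ↔ A ∈ 𝓝 w) (fun x hx => by
      obtain ⟨N, hN, hxN, h⟩ := hstep x hx
      filter_upwards [self_mem_nhdsWithin, mem_nhdsWithin_of_mem_nhds (hN.mem_nhds hxN)]
        with z hz hzN
      exact ⟨h x ⟨hx, hxN⟩ z ⟨hz, hzN⟩, h z ⟨hz, hzN⟩ x ⟨hx, hxN⟩⟩)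
    (fun _ _ _ _ _ _ h h' => h.trans h') (fun _ _ _ _ h => h.symm)
    (mem_connectedComponentIn rfl : u ∈ E) huy
  exact hind.1 (mem_of_superset (hU.mem_nhds huU) hUA)

lemma LocallyOpenConnectedFibers.t2Space_quotient [CompactSpace X] [T2Space X]
    (hloc : LocallyOpenConnectedFibers f) (hf : Continuous f) :
    T2Space (Quotient (fiberComponentSetoid f)) := by
  rw [t2Space_iff_of_isOpenQuotientMap (π := Quotient.mk (fiberComponentSetoid f))
    ⟨Quotient.mk_surjective, continuous_quotient_mk', hloc.isOpenMap_mk hf⟩, ← isOpen_compl_iff,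
    isOpen_iff_mem_nhds]
  rintro ⟨x, x'⟩ hx
  have hxx : ¬ fiberComponentSetoid f x x' := fun h => hx (Quotient.eq.2 h)
  by_cases hfx : f x = f x'
  · set F := f ⁻¹' {f x}
    have hF : IsClosed F := isClosed_singleton.preimage hf
    have hxF : x ∈ F := rfl
    set E := connectedComponentIn F x
    have hxE : x ∈ E := mem_connectedComponentIn hxF
    have hEF : E ⊆ F := connectedComponentIn_subset _ _
    have hE : IsClosed E := isClosed_of_closure_subset <|
      isPreconnected_connectedComponentIn.closure.subset_connectedComponentIn
        (subset_closure hxE) (closure_minimal hEF hF)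
    have hFE : IsClosed (F \ E) := isClosed_of_closure_subset fun y hy => by
      have hyF : y ∈ F := closure_minimal sdiff_subset hF hy
      refine ⟨hyF, fun hyE => ?_⟩
      obtain ⟨N, C, hN, hyN, hconn, -, -⟩ := hloc y
      obtain ⟨z, hzN, hzF, hzE⟩ := mem_closure_iff.1 hy N hN hyN
      have hxy : fiberComponentSetoid f x y := hyE
      have hyz : fiberComponentSetoid f y z := hconn y hyN z hzN (Eq.trans hyF (Eq.symm hzF))
      exact hzE (Setoid.trans' _ hxy hyz)
    obtain ⟨U, V, hU, hV, hEU, hFV, hUV⟩ := SeparatedNhds.of_isCompact_isCompact hE.isCompact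
      hFE.isCompact disjoint_sdiff_right
    have hFUV : F ⊆ U ∪ V := fun y hy => by
      by_cases hyE : y ∈ E
      · exact Or.inl (hEU hyE)
      · exact Or.inr (hFV ⟨hy, hyE⟩)
    have hO : IsOpen (f '' (U ∪ V)ᶜ)ᶜ :=
      (hf.isClosedMap _ (hU.union hV).isClosed_compl).isOpen_compl
    have hxO : f x ∈ (f '' (U ∪ V)ᶜ)ᶜ := by
      rintro ⟨y, hy, hyx⟩
      exact hy (hFUV hyx)
    filter_upwards [prod_mem_nhds (inter_mem (hU.mem_nhds (hEU hxE))
      (hf.continuousAt (hO.mem_nhds hxO))) (hV.mem_nhds (hFV ⟨hfx.symm, hxx⟩))]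
    rintro ⟨y, y'⟩ ⟨⟨hyU, hyO⟩, hyV⟩ h
    have hyy : fiberComponentSetoid f y y' := Quotient.eq.1 h
    obtain ⟨z, -, hzU, hzV⟩ :=
      isPreconnected_connectedComponentIn (F := f ⁻¹' {f y}) (x := y) U V hU hV
      (fun z hz => by
        by_contra hzUV
        exact hyO ⟨z, hzUV, connectedComponentIn_subset (f ⁻¹' {f y}) y hz⟩)
      ⟨y, mem_connectedComponentIn rfl, hyU⟩ ⟨y', hyy, hyV⟩
    exact hUV.le_bot ⟨hzU, hzV⟩
  · filter_upwards [(hf.fst'.continuousAt.prodMk hf.snd'.continuousAt :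
      ContinuousAt (fun q : X × X => (f q.1, f q.2)) (x, x'))
      (isClosed_diagonal.isOpen_compl.mem_nhds hfx)] with q hq h
    exact hq (fiberComponent_map_eq (Quotient.eq.1 h))

lemma LocallyOpenConnectedFibers.exists_nhds_joinedByCurve (hloc : LocallyOpenConnectedFibers f)
    (hf : Continuous f) (q : Quotient (fiberComponentSetoid f)) :
    ∃ S ∈ 𝓝 q, ∀ y ∈ S, ∀ z ∈ S, JoinedByCurve (fiberComponentLift f) y z
      (dist (fiberComponentLift f y) (fiberComponentLift f z)) := by
  induction q using Quotient.inductionOn with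
  | _ x =>
  obtain ⟨N, C, hN, hxN, hconn, hC, hopen⟩ := hloc x
  refine _root_.exists_nhds_joinedByCurve (continuous_fiberComponentLift hf)
    (hloc.isOpenMap_mk hf N hN) (mem_image_of_mem _ hxN) ?_ hC ?_
  · rintro _ ⟨y, hy, rfl⟩ _ ⟨z, hz, rfl⟩ h
    exact Quotient.sound (hconn y hy z hz h)
  · intro U hU hUN
    obtain ⟨W, hW, h⟩ := hopen (N ∩ Quotient.mk _ ⁻¹' U)
      (hN.inter (hU.preimage continuous_quotient_mk')) inter_subset_left
    refine ⟨W, hW, h ▸ subset_antisymm ?_ ?_⟩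
    · rintro _ ⟨_, hq, rfl⟩
      obtain ⟨y, hy, rfl⟩ := hUN hq
      exact ⟨y, ⟨hy, hq⟩, rfl⟩
    · rintro _ ⟨y, hy, rfl⟩
      exact ⟨_, hy.2, rfl⟩

end FiberComponents

/-- Local-to-Global Principle: under the local conditions LC1 and LC2 on a continuous
map `f` from a connected compact Hausdorff space `X` to a connected locally compact
complete path metric space `Y`, the image `f(X)` is closed and weakly convex. -/
theorem local_to_global_principle
    {X : Type*} [TopologicalSpace X] [CompactSpace X] [T2Space X] [ConnectedSpace X]
    [CompleteSpace Y] [LocallyCompactSpace Y] [ConnectedSpace Y]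
    (hY : IsPathMetricSpace Y) (f : X → Y) (hf : Continuous f)
    (hLC1 : IsProperMap f ∧ ∀ x : X, ∃ V ∈ 𝓝 x, ∀ y ∈ V, IsConnected (f ⁻¹' {f y} ∩ V))
    (hLC2 : ∀ x : X, ∃ (C : Set Y) (V : Set X), V ∈ 𝓝 x ∧
      IsPointedClosedConvex C (f x) ∧ f '' V ⊆ C ∧
      ∀ U : Set X, IsOpen U → U ⊆ V → ∃ W : Set Y, IsOpen W ∧ f '' U = W ∩ C) :
    IsClosed (Set.range f) ∧ IsWeaklyConvex (Set.range f) := by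

  have hclosed : IsClosed (range f) := (isCompact_range hf).isClosed
  have hloc : LocallyOpenConnectedFibers f := fun x => by
    obtain ⟨V, hV, hconn⟩ := hLC1.2 x
    obtain ⟨C, V', hV', hC, -, hopen⟩ := hLC2 x
    refine ⟨interior (V ∩ V'), C, isOpen_interior,
      mem_interior_iff_mem_nhds.2 (inter_mem hV hV'), fun y hy z hz h => ?_, hC, fun U hU hUN =>
        hopen U hU (hUN.trans (interior_subset.trans inter_subset_right))⟩
    have hyV := (interior_subset hy).1
    exact fiberComponent_of_isPreconnected (hconn y hyV).isPreconnected inter_subset_left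
      ⟨rfl, hyV⟩ ⟨h.symm, (interior_subset hz).1⟩
  have := hloc.t2Space_quotient hf
  refine ⟨hclosed, hclosed, ?_⟩
  rintro _ ⟨x, rfl⟩ _ ⟨y, rfl⟩
  obtain ⟨L, c, hL, hlip, hc0, hcL, hgeo⟩ := exists_locally_unitSpeed_curve
    (continuous_fiberComponentLift hf) (hloc.exists_nhds_joinedByCurve hf)
    (Quotient.mk _ x) (Quotient.mk _ y)
  refine ⟨0, L, fiberComponentLift f ∘ c, 1, hL, hlip.lipschitzOnWith, ?_, ?_, ?_, fun t ht => ?_⟩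
  · exact congrArg (fiberComponentLift f) hc0
  · exact congrArg (fiberComponentLift f) hcL
  · rintro _ ⟨t, -, rfl⟩
    obtain ⟨z, hz⟩ := Quotient.exists_rep (c t)
    exact ⟨z, congrArg (fiberComponentLift f) hz⟩
  · obtain ⟨ε, hε, hsub, hunit⟩ := hgeo t ht
    exact ⟨ε, hε, hsub, hunit.curveLength_eq (by linarith)⟩
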